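/- Let p, q ∈ ℂ with 0 < |p| < 1 and 0 < |q| < 1, let ω ∈ ℂ with ω² = pq, and let a_0, a_1, b_0, b_1 ∈ ℂ satisfy max(|q|,|ω|) < |a_0|, |a_1| < min(1, |ω|/|p|) and max(|p|,|ω|) < |b_0|, |b_1| < min(1, |ω|/|q|). Assume θ(a_0 a_1/q;q) ≠ 0, θ(a_0/a_1;q) ≠ 0, θ(b_0 b_1/p;p) ≠ 0 and θ(b_0/b_1;p) ≠ 0. Define F(a_0,a_1 : b_0,b_1; p,q) := ((p;p)_∞ (q;q)_∞/2) · (1/2π) ∫_0^{2π} θ(z²;q) θ(z^{−2};p) / ( θ(a_0 z;q) θ(a_0/z;q) θ(a_1 z;q) θ(a_1/z;q) θ(b_0 z;p) θ(b_0/z;p) θ(b_1 z;p) θ(b_1/z;p) ) dφ, where z = e^{iφ}. Then F(a_0,a_1 : b_0,b_1; p,q) = ( θ(a_0 a_1/q;p) θ(a_0/a_1;p) θ(b_0 b_1/p;q) θ(b_0/b_1;q) / ( θ(a_0 a_1/q;q) θ(a_0/a_1;q) θ(b_0 b_1/p;p) θ(b_0/b_1;p) ) ) · F(ω/b_0, ω/b_1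 : ω/a_0, ω/a_1; p,q). -/

import Mathlib

open scoped BigOperators Real
open MeasureTheory

/-- The theta function `θ(x;p)`. -/
noncomputable def ellTheta (x p : ℂ) : ℂ :=
  ∏' k : ℕ, ((1 - p ^ k * x) * (1 - p ^ (k + 1) / x))

/-- `(p;p)_∞`. -/
noncomputable def qPoch (p : ℂ) : ℂ := ∏' k : ℕ, (1 - p ^ (k + 1))

/-- The univariate integral `F(a_0,a_1 : b_0,b_1; p,q)`. -/
noncomputable def Ffun (a0 a1 b0 b1 p q : ℂ) : ℂ :=
  (qPoch p * qPoch q / 2) * ((1 / (2 * Real.pi) : ℝ) : ℂ) *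
    ∫ φ in Set.Icc (0 : ℝ) (2 * Real.pi),
      (fun z : ℂ =>
        ellTheta (z ^ 2) q * ellTheta (1 / z ^ 2) p /
          (ellTheta (a0 * z) q * ellTheta (a0 / z) q * ellTheta (a1 * z) q *
            ellTheta (a1 / z) q * ellTheta (b0 * z) p * ellTheta (b0 / z) p *
            ellTheta (b1 * z) p * ellTheta (b1 / z) p))
      (Complex.exp (Complex.I * φ))

/-- The infinite `q`-shifted factorial `(x;q)_∞`. -/
noncomputable def eulerProd (q x : ℂ) : ℂ := ∏' k : ℕ, (1 - q ^ k * x)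

section EulerProd

variable {q : ℂ}

lemma summable_norm_pow_mul (hq1 : ‖q‖ < 1) (x : ℂ) : Summable fun k : ℕ => ‖-(q ^ k * x)‖ := by
  simpa using (summable_geometric_of_lt_one (norm_nonneg q) hq1).mul_right ‖x‖

lemma multipliable_eulerProd (hq1 : ‖q‖ < 1) (x : ℂ) :
    Multipliable fun k : ℕ => 1 - q ^ k * x := by
  simpa [sub_eq_add_neg] using
    multipliable_one_add_of_summable (f := fun k : ℕ => -(q ^ k * x)) (summable_norm_pow_mul hq1 x)

lemma differentiable_eulerProd (hq1 : ‖q‖ < 1) : Differentiable ℂ (eulerProd q) := by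
  have h : HasProdLocallyUniformlyOn (fun (k : ℕ) (x : ℂ) => 1 - q ^ k * x) (eulerProd q)
      Set.univ := by
    unfold eulerProd
    simp_rw [sub_eq_add_neg]
    apply hasProdLocallyUniformlyOn_of_forall_compact isOpen_univ
    intro K _ hcK
    obtain ⟨B, hB⟩ := hcK.isBounded.exists_norm_le
    refine ((summable_geometric_of_lt_one (norm_nonneg q) hq1).mul_right
      B).hasProdUniformlyOn_nat_one_add hcK (.of_forall fun n x hx ↦ ?_) (fun _ ↦ by fun_prop)
    simpa using mul_le_mul_of_nonneg_left (hB x hx) (pow_nonneg (norm_nonneg q) n)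
  have := h.differentiableOn (.of_forall fun s ↦ by
    simpa [Finset.prod_fn] using DifferentiableOn.fun_finsetProd (fun _ _ ↦ by fun_prop))
      isOpen_univ
  exact differentiableOn_univ.mp this

lemma eulerProd_zero : eulerProd q 0 = 1 := by simp [eulerProd]

lemma eulerProd_eq (hq1 : ‖q‖ < 1) (x : ℂ) :
    eulerProd q x = (1 - x) * eulerProd q (q * x) := by
  unfold eulerProd
  rw [tprod_eq_zero_mul' (by simpa [pow_succ, mul_assoc] using multipliable_eulerProd hq1 (q * x))]
  simp [pow_succ, mul_assoc]

lemma eulerProd_ne_zero (hq1 : ‖q‖ < 1) {x : ℂ} (hx : ‖x‖ < 1) : eulerProd q x ≠ 0 := by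
  have := tprod_one_add_ne_zero_of_summable (f := fun k : ℕ => -(q ^ k * x)) (fun k h => ?_)
    (summable_norm_pow_mul hq1 x)
  · simpa [eulerProd, sub_eq_add_neg] using this
  · have h1 : ‖q ^ k * x‖ < 1 := by
      rw [norm_mul, norm_pow]
      calc ‖q‖ ^ k * ‖x‖ ≤ 1 * ‖x‖ := by
            gcongr; exact pow_le_one₀ (norm_nonneg _) hq1.le
        _ < 1 := by simpa
    have h2 : q ^ k * x = 1 := by linear_combination -h
    simp [h2] at h1

lemma ellTheta_eq (hq1 : ‖q‖ < 1) (x : ℂ) :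
    ellTheta x q = eulerProd q x * eulerProd q (q / x) := by
  unfold ellTheta eulerProd
  rw [← (multipliable_eulerProd hq1 x).tprod_mul (multipliable_eulerProd hq1 (q / x))]
  congr 1; ext k; ring

lemma ellTheta_eq_one_sub (hq1 : ‖q‖ < 1) (x : ℂ) :
    ellTheta x q = (1 - x) * (eulerProd q (q * x) * eulerProd q (q / x)) := by
  rw [ellTheta_eq hq1, eulerProd_eq hq1 x, mul_assoc]

lemma ellTheta_mul_left (hq0 : q ≠ 0) (hq1 : ‖q‖ < 1) {x : ℂ} (hx : x ≠ 0) :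
    ellTheta (q * x) q = -x⁻¹ * ellTheta x q := by
  rw [ellTheta_eq_one_sub hq1 x, ellTheta_eq hq1, div_mul_cancel_left₀ hq0, eulerProd_eq hq1 x⁻¹,
    ← div_eq_mul_inv]
  field_simp
  ring

lemma ellTheta_inv (hq1 : ‖q‖ < 1) {x : ℂ} (hx : x ≠ 0) :
    ellTheta x⁻¹ q = -x⁻¹ * ellTheta x q := by
  rw [ellTheta_eq_one_sub hq1 x, ellTheta_eq_one_sub hq1, div_inv_eq_mul, ← div_eq_mul_inv]
  field_simp
  ring

lemma ellTheta_div (hq0 : q ≠ 0) (hq1 : ‖q‖ < 1) {x : ℂ} (hx : x ≠ 0) :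
    ellTheta (q / x) q = ellTheta x q := by
  rw [div_eq_mul_inv, ellTheta_mul_left hq0 hq1 (inv_ne_zero hx), ellTheta_inv hq1 hx]
  field_simp

lemma ellTheta_one (hq1 : ‖q‖ < 1) : ellTheta 1 q = 0 := by
  simp [ellTheta_eq_one_sub hq1]

lemma ellTheta_ne_zero (hq1 : ‖q‖ < 1) {x : ℂ} (hx0 : x ≠ 0) (hx : ‖q * x‖ < 1) (hx' : ‖q‖ < ‖x‖)
    (hx1 : x ≠ 1) : ellTheta x q ≠ 0 := by
  rw [ellTheta_eq_one_sub hq1]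
  refine mul_ne_zero (sub_ne_zero.mpr hx1.symm)
    (mul_ne_zero (eulerProd_ne_zero hq1 hx) (eulerProd_ne_zero hq1 ?_))
  rw [norm_div, div_lt_one (norm_pos_iff.mpr hx0)]
  exact hx'

lemma differentiableOn_ellTheta (hq1 : ‖q‖ < 1) :
    DifferentiableOn ℂ (fun x => ellTheta x q) {0}ᶜ := by
  have h := differentiable_eulerProd hq1
  intro x hx
  simp_rw [ellTheta_eq hq1]
  refine DifferentiableAt.differentiableWithinAt ?_
  exact (h x).mul ((h _).comp x ((differentiableAt_const q).div differentiableAt_id hx))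

lemma deriv_ellTheta_one_ne_zero (hq1 : ‖q‖ < 1) : deriv (fun x => ellTheta x q) 1 ≠ 0 := by
  have h := differentiable_eulerProd hq1
  have hg : DifferentiableAt ℂ (fun x => eulerProd q (q * x) * eulerProd q (q / x)) 1 := by
    refine DifferentiableAt.mul ?_ ?_
    · exact (h _).comp 1 (by fun_prop)
    · exact (h _).comp 1 ((differentiableAt_const q).div differentiableAt_id one_ne_zero)
  have h2 : HasDerivAt (fun x : ℂ => 1 - x) (-1) 1 := by
    simpa using (hasDerivAt_id (1 : ℂ)).const_sub 1
  have h3 := (h2.mul hg.hasDerivAt).deriv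
  have h4 : (fun x => ellTheta x q) =
      (fun x : ℂ => 1 - x) * fun x => eulerProd q (q * x) * eulerProd q (q / x) := by
    ext x; exact ellTheta_eq_one_sub hq1 x
  rw [h4, h3]
  simpa using eulerProd_ne_zero hq1 hq1

/-- The derivative `x ↦ x θ'(x;q)` of the theta function in the variable `log x`. -/
noncomputable def eulerTheta (q x : ℂ) : ℂ := x * deriv (fun y => ellTheta y q) x

lemma differentiableOn_eulerTheta (hq1 : ‖q‖ < 1) : DifferentiableOn ℂ (eulerTheta q) {0}ᶜ :=
  differentiableOn_id.mul ((differentiableOn_ellTheta hq1).deriv isOpen_compl_singleton)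

lemma hasDerivAt_ellTheta (hq1 : ‖q‖ < 1) {x : ℂ} (hx : x ≠ 0) :
    HasDerivAt (fun y => ellTheta y q) (x⁻¹ * eulerTheta q x) x := by
  rw [eulerTheta, inv_mul_cancel_left₀ hx]
  exact ((differentiableOn_ellTheta hq1).differentiableAt
    (isOpen_compl_singleton.mem_nhds hx)).hasDerivAt

lemma eulerTheta_mul_left (hq0 : q ≠ 0) (hq1 : ‖q‖ < 1) {x : ℂ} (hx : x ≠ 0) :
    eulerTheta q (q * x) = -x⁻¹ * (eulerTheta q x - ellTheta x q) := by
  have h1 : HasDerivAt (fun y => ellTheta (q * y) q) _ x :=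
    HasDerivAt.comp x (hasDerivAt_ellTheta hq1 (mul_ne_zero hq0 hx)) ((hasDerivAt_id x).const_mul q)
  have h2 := (hasDerivAt_inv hx).neg.mul (hasDerivAt_ellTheta hq1 hx)
  have h3 := h1.unique (h2.congr_of_eventuallyEq ?_)
  · simp only [Pi.neg_apply] at h3
    field_simp at h3 ⊢
    linear_combination h3
  · filter_upwards [isOpen_compl_singleton.mem_nhds hx] with y hy
    exact ellTheta_mul_left hq0 hq1 hy

lemma eulerTheta_inv (hq1 : ‖q‖ < 1) {x : ℂ} (hx : x ≠ 0) :
    eulerTheta q x⁻¹ = x⁻¹ * (eulerTheta q x - ellTheta x q) := by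
  have h1 : HasDerivAt (fun y => ellTheta y⁻¹ q) _ x :=
    HasDerivAt.comp x (hasDerivAt_ellTheta hq1 (inv_ne_zero hx)) (hasDerivAt_inv hx)
  have h2 := (hasDerivAt_inv hx).neg.mul (hasDerivAt_ellTheta hq1 hx)
  have h3 := h1.unique (h2.congr_of_eventuallyEq ?_)
  · simp only [Pi.neg_apply] at h3
    field_simp at h3 ⊢
    linear_combination -h3
  · filter_upwards [isOpen_compl_singleton.mem_nhds hx] with y hy
    exact ellTheta_inv hq1 hy

lemma one_sub_pow_ne_zero (hq1 : ‖q‖ < 1) (n : ℕ) : 1 - q ^ (n + 1) ≠ 0 := by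
  intro h
  have h1 : ‖q ^ (n + 1)‖ < 1 := by
    rw [norm_pow]; exact pow_lt_one₀ (norm_nonneg _) hq1 (by simp)
  rw [← sub_eq_zero.mp h] at h1
  simp at h1

lemma summable_norm_pow_div (hq1 : ‖q‖ < 1) {x : ℂ} (hx : ‖x‖ < 1) :
    Summable fun n : ℕ => ‖x ^ (n + 1) / (1 - q ^ (n + 1))‖ := by
  have hs := ((summable_nat_add_iff 1).mpr
    (summable_geometric_of_lt_one (norm_nonneg x) hx)).div_const (1 - ‖q‖)
  refine hs.of_nonneg_of_le (fun _ => norm_nonneg _) fun n => ?_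
  rw [norm_div, norm_pow]
  have h1 : 1 - ‖q‖ ≤ ‖1 - q ^ (n + 1)‖ := by
    have h2 := norm_sub_norm_le (1 : ℂ) (q ^ (n + 1))
    have h3 : ‖q‖ ^ (n + 1) ≤ ‖q‖ := pow_le_of_le_one (norm_nonneg _) hq1.le (by simp)
    rw [norm_one, norm_pow] at h2
    linarith
  gcongr

/-- The Lambert series `∑ xⁿ / (1 - qⁿ)`, summed over `n ≥ 1`. -/
noncomputable def lambertSeries (q x : ℂ) : ℂ := ∑' n : ℕ, x ^ (n + 1) / (1 - q ^ (n + 1))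

lemma hasSum_lambertSeries (hq1 : ‖q‖ < 1) {x : ℂ} (hx : ‖x‖ < 1) :
    HasSum (fun n : ℕ => x ^ (n + 1) / (1 - q ^ (n + 1))) (lambertSeries q x) :=
  (summable_norm_pow_div hq1 hx).of_norm.hasSum

lemma norm_mul_lt_one (hq1 : ‖q‖ < 1) {x : ℂ} (hx : ‖x‖ < 1) : ‖q * x‖ < 1 := by
  rw [norm_mul]; exact mul_lt_one_of_nonneg_of_lt_one_left (norm_nonneg _) hq1 hx.le

lemma lambertSeries_sub (hq1 : ‖q‖ < 1) {x : ℂ} (hx : ‖x‖ < 1) :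
    lambertSeries q x - lambertSeries q (q * x) = x / (1 - x) := by
  have h := (hasSum_lambertSeries hq1 hx).sub (hasSum_lambertSeries hq1 (norm_mul_lt_one hq1 hx))
  have h2 := (hasSum_geometric_of_norm_lt_one hx).mul_left x
  rw [div_eq_mul_inv]
  refine h.unique ?_
  rwa [show (fun n : ℕ => x ^ (n + 1) / (1 - q ^ (n + 1)) - (q * x) ^ (n + 1) / (1 - q ^ (n + 1))) =
    fun n => x * x ^ n from funext fun n => ?_]
  have := one_sub_pow_ne_zero hq1 n
  rw [mul_pow]
  field_simp
  ring

lemma tendsto_lambertSeries (hq1 : ‖q‖ < 1) {x : ℂ} (hx : ‖x‖ < 1) :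
    Filter.Tendsto (fun N : ℕ => lambertSeries q (q ^ N * x)) Filter.atTop (nhds 0) := by
  have hs := summable_norm_pow_div hq1 hx
  have h0 : Filter.Tendsto (fun N : ℕ => ‖q‖ ^ N * ∑' n : ℕ, ‖x ^ (n + 1) / (1 - q ^ (n + 1))‖)
      Filter.atTop (nhds 0) := by
    simpa using (tendsto_pow_atTop_nhds_zero_of_lt_one (norm_nonneg q) hq1).mul_const _
  refine squeeze_zero_norm (fun N => ?_) h0
  rw [← tsum_mul_left]
  refine tsum_of_norm_bounded (hs.mul_left _).hasSum fun n => ?_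
  rw [mul_pow, mul_div_assoc, norm_mul]
  gcongr
  rw [norm_pow, norm_pow, ← pow_mul]
  exact pow_le_pow_of_le_one (norm_nonneg _) hq1.le (Nat.le_mul_of_pos_right N (by simp))

lemma mul_deriv_eulerProd (hq1 : ‖q‖ < 1) {x : ℂ} (hx : ‖x‖ < 1) :
    x * deriv (eulerProd q) x = -(eulerProd q x * lambertSeries q x) := by
  have hP := differentiable_eulerProd hq1
  have hcont : Continuous (deriv (eulerProd q)) := by
    have := hP.contDiff (n := 1)
    exact this.continuous_deriv le_rfl
  set M : ℂ → ℂ := fun y => y * deriv (eulerProd q) y / eulerProd q y with hM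
  have hstep : ∀ y : ℂ, ‖y‖ < 1 →
      M y + lambertSeries q y = M (q * y) + lambertSeries q (q * y) := by
    intro y hy
    have h1 := lambertSeries_sub hq1 hy
    have hy1 : 1 - y ≠ 0 := by
      intro h
      rw [← sub_eq_zero.mp h] at hy
      simp at hy
    have hne := eulerProd_ne_zero hq1 (norm_mul_lt_one hq1 hy)
    have hd : HasDerivAt (fun z => (1 - z) * eulerProd q (q * z)) _ y :=
      ((hasDerivAt_id y).const_sub 1).mul
        (HasDerivAt.comp y (hP (q * y)).hasDerivAt ((hasDerivAt_id y).const_mul q))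
    rw [← show eulerProd q = fun z => (1 - z) * eulerProd q (q * z) from
      funext (eulerProd_eq hq1)] at hd
    have h2 : M y - M (q * y) = -(y / (1 - y)) := by
      simp only [hM]
      rw [hd.deriv, eulerProd_eq hq1 y]
      simp only [id]
      generalize eulerProd q (q * y) = A at *
      field_simp
      ring
    linear_combination h2 + h1
  have hiter : ∀ N : ℕ, M (q ^ N * x) + lambertSeries q (q ^ N * x) = M x + lambertSeries q x := by
    intro N
    induction N with
    | zero => simp
    | succ N ih =>
      have hN : ‖q ^ N * x‖ < 1 := by
        rw [norm_mul, norm_pow]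
        exact mul_lt_one_of_nonneg_of_lt_one_right (pow_le_one₀ (norm_nonneg _) hq1.le)
          (norm_nonneg _) hx
      rw [← ih, hstep _ hN, pow_succ', mul_assoc]
  have hM0 : ContinuousAt M 0 := by
    refine ContinuousAt.div (by fun_prop) hP.continuous.continuousAt ?_
    simp [eulerProd_zero]
  have hq : Filter.Tendsto (fun N : ℕ => q ^ N * x) Filter.atTop (nhds 0) := by
    simpa using (tendsto_pow_atTop_nhds_zero_of_norm_lt_one hq1).mul_const x
  have hlim := (hM0.tendsto.comp hq).add (tendsto_lambertSeries hq1 hx)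
  have h0 : M x + lambertSeries q x = 0 := by
    simpa [hM] using tendsto_nhds_unique tendsto_const_nhds (hlim.congr hiter)
  have hne := eulerProd_ne_zero hq1 hx
  simp only [hM] at h0
  field_simp at h0
  linear_combination h0

/-- Lambert expansion of the logarithmic derivative of the theta function. -/
lemma eulerTheta_eq (hq1 : ‖q‖ < 1) {x : ℂ} (hx : ‖x‖ < 1) (hx' : ‖q‖ < ‖x‖) :
    eulerTheta q x = ellTheta x q * (lambertSeries q (q / x) - lambertSeries q x) := by
  have hP := differentiable_eulerProd hq1
  have hx0 : x ≠ 0 := norm_pos_iff.mp ((norm_nonneg q).trans_lt hx')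
  have hqx : ‖q / x‖ < 1 := by
    rwa [norm_div, div_lt_one (norm_pos_iff.mpr hx0)]
  have hd' := (hP (q * x⁻¹)).hasDerivAt.comp x ((hasDerivAt_inv hx0).const_mul q)
  have hd : HasDerivAt (fun z => eulerProd q z * eulerProd q (q * z⁻¹)) _ x :=
    (hP x).hasDerivAt.mul hd'
  have h1 := mul_deriv_eulerProd hq1 hx
  have h2 := mul_deriv_eulerProd hq1 hqx
  rw [eulerTheta, ellTheta_eq hq1]
  simp_rw [ellTheta_eq hq1, div_eq_mul_inv] at *
  rw [hd.deriv]
  have h3 : x * (eulerProd q x * (deriv (eulerProd q) (q * x⁻¹) * (q * -(x ^ 2)⁻¹))) =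
    -(eulerProd q x * (q * x⁻¹ * deriv (eulerProd q) (q * x⁻¹))) := by
    field_simp
  rw [mul_add, h3, h2]
  linear_combination eulerProd q (q * x⁻¹) * h1

end EulerProd

section Laurent

/-- The `n`-th Laurent coefficient of `f` at the origin, read off the unit circle. -/
noncomputable def laurentCoeff (f : ℂ → ℂ) (n : ℤ) : ℂ :=
  Real.circleAverage (fun z => z ^ (-n) * f z) 0 1

lemma circleAverage_mul_left (f : ℂ → ℂ) (c : ℂ) :
    Real.circleAverage (fun z => f (c * z)) 0 1 = Real.circleAverage f 0 ‖c‖ := by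
  rw [Real.circleAverage_eq_integral_add (R := ‖c‖) (Complex.arg c), Real.circleAverage]
  congr 2
  ext θ
  congr 1
  simp only [circleMap_zero]
  conv_lhs => rw [← Complex.norm_mul_exp_arg_mul_I c]
  rw [Complex.ofReal_one, one_mul, Complex.ofReal_add, add_mul, Complex.exp_add]
  ring

lemma circleAverage_eq_of_differentiableOn {f : ℂ → ℂ} (hf : DifferentiableOn ℂ f {0}ᶜ) {r s : ℝ}
    (hr : 0 < r) (hs : 0 < s) : Real.circleAverage f 0 r = Real.circleAverage f 0 s := by
  wlog h : s ≤ r generalizing r s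
  · exact (this hs hr (le_of_not_ge h)).symm
  rw [Real.circleAverage_eq_circleIntegral hr.ne', Real.circleAverage_eq_circleIntegral hs.ne']
  have hg : DifferentiableOn ℂ (fun z => (z - 0)⁻¹ • f z) {0}ᶜ := by
    simp only [sub_zero]
    exact (differentiableOn_inv.mono fun _ h => h).smul hf
  congr 1
  refine Complex.circleIntegral_eq_of_differentiable_on_annulus_off_countable hs h
    Set.countable_empty (hg.continuousOn.mono ?_) ?_
  · rintro z ⟨_, hz⟩ rfl
    exact hz (Metric.mem_ball_self hs)
  · rintro z ⟨⟨_, hz⟩, _⟩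
    refine hg.differentiableAt (isOpen_compl_singleton.mem_nhds ?_)
    rintro rfl
    exact hz (Metric.mem_closedBall_self hs.le)

lemma differentiableOn_zpow_mul {f : ℂ → ℂ} (hf : DifferentiableOn ℂ f {0}ᶜ) (n : ℤ) :
    DifferentiableOn ℂ (fun z => z ^ n * f z) {0}ᶜ :=
  (differentiableOn_zpow n _ (Or.inl (by simp))).mul hf

/-- A function on a circle all of whose Fourier coefficients vanish is zero. -/
lemma eq_zero_of_circleAverage_eq_zero {f : ℂ → ℂ} {r : ℝ} (hr : 0 < r)
    (hf : ContinuousOn f (Metric.sphere 0 r))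
    (h : ∀ n : ℤ, Real.circleAverage (fun z => z ^ n * f z) 0 r = 0) {z : ℂ} (hz : ‖z‖ = r) :
    f z = 0 := by
  have : Fact (0 < 2 * π) := ⟨Real.two_pi_pos⟩
  have hmem : ∀ x : AddCircle (2 * π), (r : ℂ) * (AddCircle.toCircle x : ℂ) ∈
      Metric.sphere (0 : ℂ) r := by
    intro x; simp [abs_of_pos hr, Circle.norm_coe]
  let F : C(AddCircle (2 * π), ℂ) := ⟨fun x => f (r * (AddCircle.toCircle x : ℂ)),
    hf.comp_continuous (continuous_const.mul
      (continuous_subtype_val.comp AddCircle.continuous_toCircle)) hmem⟩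
  have hpt : ∀ θ : ℝ, (r : ℂ) * (AddCircle.toCircle (θ : AddCircle (2 * π)) : ℂ) =
      circleMap 0 r θ := by
    intro θ
    rw [AddCircle.toCircle_apply_mk, Circle.coe_exp, circleMap_zero]
    congr 3
    field_simp
  have hcoef : ∀ n : ℤ, fourierCoeff F n = 0 := by
    intro n
    rw [fourierCoeff_eq_intervalIntegral F n 0]
    have h1 := h (-n)
    rw [Real.circleAverage, smul_eq_zero_iff_right (by positivity)] at h1
    rw [smul_eq_zero_iff_right (by positivity), zero_add]
    have h2 : ∀ θ : ℝ, fourier (-n) (θ : AddCircle (2 * π)) • F θ =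
        (r : ℂ) ^ n * ((circleMap 0 r θ) ^ (-n) * f (circleMap 0 r θ)) := by
      intro θ
      have hr' : (r : ℂ) ≠ 0 := by exact_mod_cast hr.ne'
      rw [← hpt θ, smul_eq_mul, fourier_apply, AddCircle.toCircle_zsmul, Circle.coe_zpow, mul_zpow,
        zpow_neg (r : ℂ)]
      simp only [F, ContinuousMap.coe_mk]
      field_simp
    simp_rw [h2]
    rw [intervalIntegral.integral_const_mul, h1, mul_zero]
  have hsum := hasSum_fourier_series_of_summable (f := F) (by
    rw [show fourierCoeff F = 0 from funext hcoef]; exact summable_zero)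
  simp only [hcoef, zero_smul] at hsum
  have hF : F = 0 := hsum.unique hasSum_zero
  have := congrArg (fun G : C(AddCircle (2 * π), ℂ) => G (Complex.arg z : ℝ)) hF
  simp only [F, ContinuousMap.coe_mk, hpt, ContinuousMap.zero_apply] at this
  rwa [circleMap_zero, ← hz, Complex.norm_mul_exp_arg_mul_I] at this

lemma eq_zero_of_laurentCoeff_eq_zero {f : ℂ → ℂ} (hf : DifferentiableOn ℂ f {0}ᶜ)
    (h : ∀ n, laurentCoeff f n = 0) {z : ℂ} (hz : z ≠ 0) : f z = 0 := by
  refine eq_zero_of_circleAverage_eq_zero (norm_pos_iff.mpr hz) (hf.continuousOn.mono ?_)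
    (fun n => ?_) rfl
  · rintro w hw rfl
    simp only [mem_sphere_iff_norm, sub_zero, norm_zero] at hw
    exact hz (norm_eq_zero.mp hw.symm)
  · rw [circleAverage_eq_of_differentiableOn (differentiableOn_zpow_mul hf n)
      (norm_pos_iff.mpr hz) one_pos]
    simpa [laurentCoeff] using h (-n)

variable {q : ℂ} {f : ℂ → ℂ}

lemma laurentCoeff_add_four (hq0 : q ≠ 0) (hf : DifferentiableOn ℂ f {0}ᶜ)
    (hmul : ∀ z ≠ 0, f (q * z) = z ^ (-4 : ℤ) * f z) (n : ℤ) :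
    laurentCoeff f (n + 4) = q ^ n * laurentCoeff f n := by
  have h1 := circleAverage_eq_of_differentiableOn (differentiableOn_zpow_mul hf (-n)) one_pos
    (norm_pos_iff.mpr hq0)
  rw [laurentCoeff, laurentCoeff, h1, ← circleAverage_mul_left, ← smul_eq_mul,
    ← Real.circleAverage_fun_smul]
  refine Real.circleAverage_congr_sphere fun z hz => ?_
  have hz0 : z ≠ 0 := by rintro rfl; simp at hz
  simp only [smul_eq_mul]
  rw [hmul z hz0, mul_zpow, neg_add, zpow_add₀ hz0, zpow_neg q]
  field_simp

lemma laurentCoeff_neg (hinv : ∀ z ≠ 0, f z⁻¹ = -z ^ (-4 : ℤ) * f z) (n : ℤ) :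
    laurentCoeff f (-n) = -laurentCoeff f (n + 4) := by
  rw [laurentCoeff, ← Real.circleAverage_zero_one_congr_inv, laurentCoeff,
    ← neg_one_smul ℝ (Real.circleAverage _ _ _),
    ← Real.circleAverage_fun_smul]
  refine Real.circleAverage_congr_sphere fun z hz => ?_
  have hz0 : z ≠ 0 := by rintro rfl; simp at hz
  rw [hinv z hz0, neg_add, zpow_add₀ hz0, neg_neg, inv_zpow, zpow_neg z n]
  simp
  ring

/-- Antisymmetric theta functions of degree four are determined by their first Laurent
coefficient. -/
lemma eq_zero_of_laurentCoeff_one_eq_zero (hq0 : q ≠ 0) (hf : DifferentiableOn ℂ f {0}ᶜ)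
    (hmul : ∀ z ≠ 0, f (q * z) = z ^ (-4 : ℤ) * f z)
    (hinv : ∀ z ≠ 0, f z⁻¹ = -z ^ (-4 : ℤ) * f z) (h1 : laurentCoeff f 1 = 0)
    {z : ℂ} (hz : z ≠ 0) : f z = 0 := by
  have hm := laurentCoeff_add_four hq0 hf hmul
  have hi := laurentCoeff_neg hinv
  have h3 : laurentCoeff f 3 = 0 := by
    have := hi (-1)
    norm_num [h1] at this
    exact this
  have h0 : laurentCoeff f 0 = 0 := by
    have e1 := hi 0
    have e2 := hm 0
    norm_num at e1 e2
    rw [e2] at e1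
    exact self_eq_neg.mp e1
  have h2 : laurentCoeff f 2 = 0 := by
    have e1 := hi (-2)
    norm_num at e1
    exact self_eq_neg.mp e1
  have hup : ∀ n, laurentCoeff f n = 0 ↔ laurentCoeff f (n + 4) = 0 := fun n => by
    rw [hm n, mul_eq_zero, or_iff_right (zpow_ne_zero n hq0)]
  have hall : ∀ k r : ℤ, laurentCoeff f r = 0 ↔ laurentCoeff f (r + 4 * k) = 0 := by
    intro k r
    induction k using Int.induction_on with
    | zero => simp
    | succ i ih => rw [ih, hup]; ring_nf
    | pred i ih => rw [ih, hup (r + 4 * (-(i : ℤ) - 1))]; ring_nf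
  refine eq_zero_of_laurentCoeff_eq_zero hf (fun n => ?_) hz
  rw [← Int.emod_add_mul_ediv n 4, ← hall]
  have ha := Int.emod_nonneg n (b := 4) (by norm_num)
  have hb := Int.emod_lt_of_pos n (b := 4) (by norm_num)
  interval_cases (n % 4) <;> assumption

lemma laurentCoeff_const_mul_sub {g : ℂ → ℂ} (hf : DifferentiableOn ℂ f {0}ᶜ)
    (hg : DifferentiableOn ℂ g {0}ᶜ) (a b : ℂ) (n : ℤ) :
    laurentCoeff (fun z => a * f z - b * g z) n = a * laurentCoeff f n - b * laurentCoeff g n := by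
  have hc : ∀ {h : ℂ → ℂ} (c : ℂ), DifferentiableOn ℂ h {0}ᶜ →
      CircleIntegrable (fun z => c • (z ^ (-n) * h z)) 0 1 := by
    intro h c hh
    refine ContinuousOn.circleIntegrable zero_le_one ?_
    refine (((differentiableOn_zpow_mul hh (-n)).continuousOn).const_smul c).mono ?_
    rintro w hw rfl
    simp at hw
  simp only [laurentCoeff]
  rw [← smul_eq_mul a, ← smul_eq_mul b, ← Real.circleAverage_fun_smul,
    ← Real.circleAverage_fun_smul,
    ← Real.circleAverage_fun_sub (hc a hf) (hc b hg)]
  congr 1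
  ext z
  simp only [smul_eq_mul]
  ring

/-- The space of antisymmetric theta functions of degree four is one-dimensional. -/
lemma exists_eq_const_mul {g : ℂ → ℂ} (hq0 : q ≠ 0) (hf : DifferentiableOn ℂ f {0}ᶜ)
    (hmul : ∀ z ≠ 0, f (q * z) = z ^ (-4 : ℤ) * f z)
    (hinv : ∀ z ≠ 0, f z⁻¹ = -z ^ (-4 : ℤ) * f z)
    (hg : DifferentiableOn ℂ g {0}ᶜ)
    (hgmul : ∀ z ≠ 0, g (q * z) = z ^ (-4 : ℤ) * g z)
    (hginv : ∀ z ≠ 0, g z⁻¹ = -z ^ (-4 : ℤ) * g z) {w : ℂ} (hw : w ≠ 0) (hgw : g w ≠ 0) :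
    ∃ κ : ℂ, ∀ z ≠ 0, f z = κ * g z := by
  have hg1 : laurentCoeff g 1 ≠ 0 := fun h =>
    hgw (eq_zero_of_laurentCoeff_one_eq_zero hq0 hg hgmul hginv h hw)
  refine ⟨laurentCoeff f 1 / laurentCoeff g 1, fun z hz => ?_⟩
  have := eq_zero_of_laurentCoeff_one_eq_zero hq0
    (f := fun z => laurentCoeff g 1 * f z - laurentCoeff f 1 * g z)
    ((hf.const_mul _).sub (hg.const_mul _))
    (fun z hz => by rw [hmul z hz, hgmul z hz]; ring)
    (fun z hz => by rw [hinv z hz, hginv z hz]; ring)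
    (by rw [laurentCoeff_const_mul_sub hf hg]; ring) hz
  field_simp
  linear_combination this

end Laurent

section PartialFractions

variable {q : ℂ}

/-- The numerator of the logarithmic derivative of
`θ(az;q) θ(z/a;q) / (θ(bz;q) θ(z/b;q))`. -/
noncomputable def thetaWronskian (q a b z : ℂ) : ℂ :=
  (eulerTheta q (a * z) * ellTheta (z / a) q + ellTheta (a * z) q * eulerTheta q (z / a)) *
      (ellTheta (b * z) q * ellTheta (z / b) q) -
    ellTheta (a * z) q * ellTheta (z / a) q *
      (eulerTheta q (b * z) * ellTheta (z / b) q + ellTheta (b * z) q * eulerTheta q (z / b))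

lemma differentiableOn_comp_mul {f : ℂ → ℂ} (hf : DifferentiableOn ℂ f {0}ᶜ) {a : ℂ} (ha : a ≠ 0) :
    DifferentiableOn ℂ (fun z => f (a * z)) {0}ᶜ :=
  hf.comp (differentiableOn_id.const_mul a) fun _ hz => mul_ne_zero ha hz

lemma differentiableOn_comp_div {f : ℂ → ℂ} (hf : DifferentiableOn ℂ f {0}ᶜ) {a : ℂ} (ha : a ≠ 0) :
    DifferentiableOn ℂ (fun z => f (z / a)) {0}ᶜ :=
  hf.comp (differentiableOn_id.div_const a) fun _ hz => div_ne_zero hz ha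

lemma differentiableOn_comp_const_div {f : ℂ → ℂ} (hf : DifferentiableOn ℂ f {0}ᶜ) {a : ℂ}
    (ha : a ≠ 0) : DifferentiableOn ℂ (fun z => f (a / z)) {0}ᶜ :=
  hf.comp ((differentiableOn_const a).div differentiableOn_id fun _ hz => hz)
    fun _ hz => div_ne_zero ha hz

lemma differentiableOn_thetaWronskian (hq1 : ‖q‖ < 1) {a b : ℂ} (ha : a ≠ 0) (hb : b ≠ 0) :
    DifferentiableOn ℂ (thetaWronskian q a b) {0}ᶜ := by
  have hA := differentiableOn_ellTheta hq1
  have hD := differentiableOn_eulerTheta hq1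
  have h1 := differentiableOn_comp_mul hA ha
  have h2 := differentiableOn_comp_mul hA hb
  have h3 := differentiableOn_comp_div hA ha
  have h4 := differentiableOn_comp_div hA hb
  have h5 := differentiableOn_comp_mul hD ha
  have h6 := differentiableOn_comp_mul hD hb
  have h7 := differentiableOn_comp_div hD ha
  have h8 := differentiableOn_comp_div hD hb
  exact (((h5.mul h3).add (h1.mul h7)).mul (h2.mul h4)).sub
    ((h1.mul h3).mul ((h6.mul h4).add (h2.mul h8)))

lemma thetaWronskian_mul_left (hq0 : q ≠ 0) (hq1 : ‖q‖ < 1) {a b : ℂ} (ha : a ≠ 0) (hb : b ≠ 0)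
    {z : ℂ} (hz : z ≠ 0) :
    thetaWronskian q a b (q * z) = z ^ (-4 : ℤ) * thetaWronskian q a b z := by
  simp only [thetaWronskian, mul_left_comm _ q z, mul_div_assoc]
  simp only [eulerTheta_mul_left hq0 hq1 (mul_ne_zero ha hz),
    eulerTheta_mul_left hq0 hq1 (mul_ne_zero hb hz),
    eulerTheta_mul_left hq0 hq1 (div_ne_zero hz ha),
    eulerTheta_mul_left hq0 hq1 (div_ne_zero hz hb), ellTheta_mul_left hq0 hq1 (mul_ne_zero ha hz),
    ellTheta_mul_left hq0 hq1 (mul_ne_zero hb hz), ellTheta_mul_left hq0 hq1 (div_ne_zero hz ha),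
    ellTheta_mul_left hq0 hq1 (div_ne_zero hz hb)]
  rw [zpow_neg, show (4 : ℤ) = ((4 : ℕ) : ℤ) from rfl, zpow_natCast]
  field_simp
  ring

lemma thetaWronskian_inv (hq1 : ‖q‖ < 1) {a b : ℂ} (ha : a ≠ 0) (hb : b ≠ 0)
    {z : ℂ} (hz : z ≠ 0) :
    thetaWronskian q a b z⁻¹ = -z ^ (-4 : ℤ) * thetaWronskian q a b z := by
  have e1 : ∀ c : ℂ, c * z⁻¹ = (z / c)⁻¹ := fun c => by rw [inv_div, div_eq_mul_inv]
  have e2 : ∀ c : ℂ, z⁻¹ / c = (c * z)⁻¹ := fun c => by rw [mul_inv, div_eq_mul_inv, mul_comm]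
  simp only [thetaWronskian, e1, e2]
  simp only [eulerTheta_inv hq1 (mul_ne_zero ha hz),
    eulerTheta_inv hq1 (mul_ne_zero hb hz), eulerTheta_inv hq1 (div_ne_zero hz ha),
    eulerTheta_inv hq1 (div_ne_zero hz hb), ellTheta_inv hq1 (mul_ne_zero ha hz),
    ellTheta_inv hq1 (mul_ne_zero hb hz), ellTheta_inv hq1 (div_ne_zero hz ha),
    ellTheta_inv hq1 (div_ne_zero hz hb)]
  rw [zpow_neg, show (4 : ℤ) = ((4 : ℕ) : ℤ) from rfl, zpow_natCast]
  field_simp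
  ring

lemma exists_thetaWronskian_eq (hq0 : q ≠ 0) (hq1 : ‖q‖ < 1) {a b : ℂ} (ha : a ≠ 0) (hb : b ≠ 0) :
    ∃ κ : ℂ, ∀ z ≠ 0, thetaWronskian q a b z = κ * (z * ellTheta (z ^ 2) q) := by
  refine exists_eq_const_mul hq0 (differentiableOn_thetaWronskian hq1 ha hb)
    (fun z hz => thetaWronskian_mul_left hq0 hq1 ha hb hz)
    (fun z hz => thetaWronskian_inv hq1 ha hb hz) ?_ ?_ ?_ Complex.I_ne_zero ?_
  · exact differentiableOn_id.mul ((differentiableOn_ellTheta hq1).comp (differentiableOn_id.pow 2)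
      fun z hz => pow_ne_zero 2 hz)
  · intro z hz
    rw [show (q * z) ^ 2 = q * (q * z ^ 2) by ring,
      ellTheta_mul_left hq0 hq1 (mul_ne_zero hq0 (pow_ne_zero 2 hz)),
      ellTheta_mul_left hq0 hq1 (pow_ne_zero 2 hz), zpow_neg,
      show (4 : ℤ) = ((4 : ℕ) : ℤ) from rfl, zpow_natCast]
    field_simp
  · intro z hz
    rw [inv_pow, ellTheta_inv hq1 (pow_ne_zero 2 hz), zpow_neg,
      show (4 : ℤ) = ((4 : ℕ) : ℤ) from rfl, zpow_natCast]
    field_simp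
  · rw [Complex.I_sq]
    exact mul_ne_zero Complex.I_ne_zero
      (ellTheta_ne_zero hq1 (by norm_num) (by simpa) (by simpa) (by norm_num))

lemma ellTheta_sq_ne_zero (hq1 : ‖q‖ < 1) {a : ℂ} (ha : ‖q‖ < ‖a‖) (ha' : ‖a‖ < 1)
    (haq : a ^ 2 ≠ q) : ellTheta (a ^ 2) q ≠ 0 := by
  have ha0 : 0 < ‖a‖ := (norm_nonneg q).trans_lt ha
  have ha0' : a ≠ 0 := norm_pos_iff.mp ha0
  rw [ellTheta_eq hq1, eulerProd_eq hq1 (q / a ^ 2)]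
  refine mul_ne_zero (eulerProd_ne_zero hq1 ?_) (mul_ne_zero ?_ (eulerProd_ne_zero hq1 ?_))
  · rw [norm_pow]; exact pow_lt_one₀ ha0.le ha' two_ne_zero
  · rw [sub_ne_zero, ne_comm, ne_eq, div_eq_one_iff_eq (pow_ne_zero 2 ha0')]
    exact haq.symm
  · rw [← mul_div_assoc, norm_div, norm_mul, norm_pow, div_lt_one (by positivity), sq]
    exact mul_self_lt_mul_self (norm_nonneg _) ha

/-- Partial fraction expansion of the theta quotient, with denominators cleared. -/
lemma mul_thetaWronskian_eq (hq0 : q ≠ 0) (hq1 : ‖q‖ < 1) {a b : ℂ} (ha : ‖q‖ < ‖a‖) (ha' : ‖a‖ < 1)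
    (hb : b ≠ 0) {z : ℂ} (hz : z ≠ 0) :
    a * thetaWronskian q a b z =
      eulerTheta q 1 * ellTheta (a * b) q * ellTheta (a / b) q * (z * ellTheta (z ^ 2) q) := by
  have hpos : 0 < ‖a‖ := (norm_nonneg q).trans_lt ha
  have ha0 : a ≠ 0 := norm_pos_iff.mp hpos
  have hgen : ∀ c : ℂ, c ≠ 0 → ellTheta (c ^ 2) q ≠ 0 → c * thetaWronskian q c b z =
      eulerTheta q 1 * ellTheta (c * b) q * ellTheta (c / b) q * (z * ellTheta (z ^ 2) q) := by
    intro c hc hc2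
    obtain ⟨κ, hκ⟩ := exists_thetaWronskian_eq hq0 hq1 hc hb
    have h1 := hκ c hc
    simp only [thetaWronskian, div_self hc, ellTheta_one hq1, ← sq, mul_comm b c] at h1
    have h2 : κ * c = eulerTheta q 1 * ellTheta (c * b) q * ellTheta (c / b) q := by
      apply mul_right_cancel₀ hc2
      linear_combination -h1
    rw [hκ z hz, ← h2]
    ring
  have hA := differentiableOn_ellTheta hq1
  have hD := differentiableOn_eulerTheta hq1
  have hat : ∀ {f : ℂ → ℂ}, DifferentiableOn ℂ f {0}ᶜ → ContinuousAt f a := fun hf =>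
    hf.continuousOn.continuousAt (isOpen_compl_singleton.mem_nhds ha0)
  have hf1 : ContinuousAt (fun c => c * thetaWronskian q c b z) a := by
    have h1 := hat (differentiableOn_comp_mul hA hz)
    have h2 := hat (differentiableOn_comp_const_div hA hz)
    have h3 := hat (differentiableOn_comp_mul hD hz)
    have h4 := hat (differentiableOn_comp_const_div hD hz)
    simp only [thetaWronskian, mul_comm _ z]
    exact continuousAt_id.mul ((((h3.mul h2).add (h1.mul h4)).mul continuousAt_const).sub
      ((h1.mul h2).mul continuousAt_const))
  have hf2 : ContinuousAt (fun c => eulerTheta q 1 * ellTheta (c * b) q * ellTheta (c / b) q *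
      (z * ellTheta (z ^ 2) q)) a := by
    have h1 := hat (differentiableOn_comp_mul hA hb)
    have h2 := hat (differentiableOn_comp_div hA hb)
    simp only [mul_comm _ b]
    exact ((continuousAt_const.mul h1).mul h2).mul continuousAt_const
  refine ((hf1.eventuallyEq_nhds_iff_eventuallyEq_nhdsNE hf2).mp ?_).eq_of_nhds
  have hne : ∀ s : ℂ, ∀ᶠ c in nhdsWithin a {a}ᶜ, c ≠ s := by
    intro s
    by_cases hs : s = a
    · rw [hs]; exact self_mem_nhdsWithin
    · exact (eventually_ne_nhds (Ne.symm hs)).filter_mono nhdsWithin_le_nhds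
  obtain ⟨s, hs⟩ := IsAlgClosed.exists_pow_nat_eq q (n := 2) two_pos
  have hopen : ∀ᶠ c in nhdsWithin a {a}ᶜ, ‖q‖ < ‖c‖ ∧ ‖c‖ < 1 :=
    ((continuous_norm.continuousAt.eventually (lt_mem_nhds ha)).and
      (continuous_norm.continuousAt.eventually (gt_mem_nhds ha'))).filter_mono nhdsWithin_le_nhds
  filter_upwards [hne s, hne (-s), hopen] with c h1 h2 h3
  refine hgen c (norm_pos_iff.mp ((norm_nonneg q).trans_lt h3.1))
    (ellTheta_sq_ne_zero hq1 h3.1 h3.2 fun h => ?_)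
  rw [← hs, sq_eq_sq_iff_eq_or_eq_neg] at h
  exact h.elim h1 h2

/-- The coefficients of the Fourier expansion of the theta quotient. -/
noncomputable def thetaCoeff (q a b : ℂ) (n : ℕ) : ℂ :=
  (a ^ (n + 1) + (q / a) ^ (n + 1) - b ^ (n + 1) - (q / b) ^ (n + 1)) / (1 - q ^ (n + 1))

/-- The function `z ↦ zⁿ - z⁻ⁿ`, with the index shifted by one. -/
noncomputable def oddPow (n : ℕ) (z : ℂ) : ℂ := z ^ (n + 1) - z⁻¹ ^ (n + 1)

/-- The odd Fourier series attached to the theta quotient. -/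
noncomputable def thetaSeries (q a b z : ℂ) : ℂ := ∑' n : ℕ, thetaCoeff q a b n * oddPow n z

lemma norm_div_lt_one {a : ℂ} (ha : ‖q‖ < ‖a‖) : ‖q / a‖ < 1 := by
  rwa [norm_div, div_lt_one ((norm_nonneg q).trans_lt ha)]

lemma summable_norm_thetaCoeff (hq1 : ‖q‖ < 1) {a b : ℂ} (ha : ‖q‖ < ‖a‖) (ha' : ‖a‖ < 1)
    (hb : ‖q‖ < ‖b‖) (hb' : ‖b‖ < 1) : Summable fun n => ‖thetaCoeff q a b n‖ := by
  refine Summable.of_nonneg_of_le (fun _ => norm_nonneg _) (fun n => ?_)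
    ((((summable_norm_pow_div hq1 ha').add (summable_norm_pow_div hq1 (norm_div_lt_one ha))).add
    (summable_norm_pow_div hq1 hb')).add (summable_norm_pow_div hq1 (norm_div_lt_one hb)))
  rw [thetaCoeff, sub_div, sub_div, add_div]
  exact (norm_sub_le _ _).trans (add_le_add_left ((norm_sub_le _ _).trans
    (add_le_add_left (norm_add_le _ _) _)) _)

lemma thetaSeries_eq (hq1 : ‖q‖ < 1) {a b : ℂ} (ha : ‖q‖ < ‖a‖) (ha' : ‖a‖ < 1)
    (hb : ‖q‖ < ‖b‖) (hb' : ‖b‖ < 1) {z : ℂ} (hz : ‖z‖ = 1) :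
    thetaSeries q a b z =
      (lambertSeries q (a * z) + lambertSeries q (q / (a / z)) - lambertSeries q (a / z) -
        lambertSeries q (q / (a * z))) -
      (lambertSeries q (b * z) + lambertSeries q (q / (b / z)) - lambertSeries q (b / z) -
        lambertSeries q (q / (b * z))) := by
  have hone : ∀ c : ℂ, ‖q‖ < ‖c‖ → ‖c‖ < 1 → HasSum (fun n => (c ^ (n + 1) + (q / c) ^ (n + 1)) /
      (1 - q ^ (n + 1)) * oddPow n z) (lambertSeries q (c * z) + lambertSeries q (q / (c / z)) -
        lambertSeries q (c / z) - lambertSeries q (q / (c * z))) := by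
    intro c hc hc'
    have h1 := hasSum_lambertSeries hq1 (x := c * z) (by simpa [hz])
    have h2 := hasSum_lambertSeries hq1 (x := c / z) (by simpa [hz])
    have h3 := hasSum_lambertSeries hq1 (x := q / (c / z)) (norm_div_lt_one (by simpa [hz]))
    have h4 := hasSum_lambertSeries hq1 (x := q / (c * z)) (norm_div_lt_one (by simpa [hz]))
    refine (((h1.add h3).sub h2).sub h4).congr_fun fun n => ?_
    simp only [oddPow, div_eq_mul_inv, mul_pow, mul_inv, inv_inv]
    ring
  refine HasSum.tsum_eq ?_
  refine ((hone a ha ha').sub (hone b hb hb')).congr_fun fun n => ?_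
  rw [thetaCoeff]
  ring

lemma eulerTheta_one_ne_zero (hq1 : ‖q‖ < 1) : eulerTheta q 1 ≠ 0 := by
  simpa [eulerTheta] using deriv_ellTheta_one_ne_zero hq1

/-- Fourier expansion of the theta quotient on the unit circle. -/
lemma ellTheta_quotient_eq (hq0 : q ≠ 0) (hq1 : ‖q‖ < 1) {a b : ℂ} (ha : ‖q‖ < ‖a‖) (ha' : ‖a‖ < 1)
    (hb : ‖q‖ < ‖b‖) (hb' : ‖b‖ < 1) (hab : ellTheta (a * b) q ≠ 0) (hab' : ellTheta (a / b) q ≠ 0)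
    {z : ℂ} (hz : ‖z‖ = 1) :
    ellTheta (z ^ 2) q /
        (ellTheta (a * z) q * ellTheta (a / z) q * ellTheta (b * z) q * ellTheta (b / z) q) =
      -z * thetaSeries q a b z /
        (b * eulerTheta q 1 * ellTheta (a * b) q * ellTheta (a / b) q) := by
  have ha0 : a ≠ 0 := norm_pos_iff.mp ((norm_nonneg q).trans_lt ha)
  have hb0 : b ≠ 0 := norm_pos_iff.mp ((norm_nonneg q).trans_lt hb)
  have hz0 : z ≠ 0 := by rintro rfl; simp at hz
  have hD : eulerTheta q 1 ≠ 0 := eulerTheta_one_ne_zero hq1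
  have hT : ∀ x : ℂ, ‖q‖ < ‖x‖ → ‖x‖ < 1 → ellTheta x q ≠ 0 := by
    intro x hx hx'
    refine ellTheta_ne_zero hq1 (norm_pos_iff.mp ((norm_nonneg q).trans_lt hx))
      (norm_mul_lt_one hq1 hx') hx ?_
    rintro rfl
    simp at hx'
  have h1 := mul_thetaWronskian_eq hq0 hq1 ha ha' hb0 hz0
  have hw : ∀ c : ℂ, ‖q‖ < ‖c‖ → ‖c‖ < 1 →
      ellTheta (c * z) q ≠ 0 ∧ ellTheta (c / z) q ≠ 0 ∧
      ellTheta (z / c) q = -(z / c) * ellTheta (c / z) q ∧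
      eulerTheta q (z / c) = z / c * (ellTheta (c / z) q *
        (lambertSeries q (q / (c / z)) - lambertSeries q (c / z)) - ellTheta (c / z) q) ∧
      eulerTheta q (c * z) = ellTheta (c * z) q *
        (lambertSeries q (q / (c * z)) - lambertSeries q (c * z)) := by
    intro c hc hc'
    have hc0 : c ≠ 0 := norm_pos_iff.mp ((norm_nonneg q).trans_lt hc)
    have n1 : ‖c * z‖ = ‖c‖ := by simp [hz]
    have n2 : ‖c / z‖ = ‖c‖ := by simp [hz]
    refine ⟨hT _ (by rwa [n1]) (by rwa [n1]), hT _ (by rwa [n2]) (by rwa [n2]), ?_, ?_, ?_⟩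
    · rw [← inv_div c z, ellTheta_inv hq1 (div_ne_zero hc0 hz0)]
    · rw [← inv_div c z, eulerTheta_inv hq1 (div_ne_zero hc0 hz0),
        eulerTheta_eq hq1 (by rwa [n2]) (by rwa [n2])]
    · rw [eulerTheta_eq hq1 (by rwa [n1]) (by rwa [n1])]
  obtain ⟨a1, a2, a3, a4, a5⟩ := hw a ha ha'
  obtain ⟨b1, b2, b3, b4, b5⟩ := hw b hb hb'
  rw [thetaSeries_eq hq1 ha ha' hb hb' hz]
  simp only [thetaWronskian, a3, a4, a5, b3, b4, b5] at h1
  rw [div_eq_div_iff (by simp [a1, a2, b1, b2]) (by simp [hb0, hD, hab, hab'])]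
  generalize ellTheta (a * z) q = A1, ellTheta (a / z) q = A2, ellTheta (b * z) q = B1,
    ellTheta (b / z) q = B2 at *
  generalize lambertSeries q (a * z) = l1, lambertSeries q (q / (a * z)) = l2,
    lambertSeries q (a / z) = l3, lambertSeries q (q / (a / z)) = l4,
    lambertSeries q (b * z) = l5, lambertSeries q (q / (b * z)) = l6,
    lambertSeries q (b / z) = l7, lambertSeries q (q / (b / z)) = l8 at *
  field_simp at h1
  linear_combination -h1

end PartialFractions

section Orthogonality

lemma integral_exp_zpow (k : ℤ) :
    ∫ φ in (0 : ℝ)..(2 * π), Complex.exp (Complex.I * φ) ^ k =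
      if k = 0 then (2 * π : ℂ) else 0 := by
  split_ifs with hk
  · simp [hk]
  · have hc : (k * Complex.I : ℂ) ≠ 0 := by simp [hk]
    have h := integral_exp_mul_complex (a := 0) (b := 2 * π) hc
    simp only [← Complex.exp_int_mul, ← mul_assoc]
    rw [h, show (k * Complex.I * ((2 * π : ℝ) : ℂ)) = k * (2 * π * Complex.I) by push_cast; ring,
      Complex.exp_int_mul_two_pi_mul_I]
    simp

lemma norm_exp_I_mul (φ : ℝ) : ‖Complex.exp (Complex.I * φ)‖ = 1 := by
  rw [mul_comm, Complex.norm_exp_ofReal_mul_I]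

lemma continuous_oddPow_exp (n : ℕ) :
    Continuous fun φ : ℝ => oddPow n (Complex.exp (Complex.I * φ)) := by
  simp only [oddPow, ← Complex.exp_neg]
  fun_prop

lemma norm_oddPow_le {z : ℂ} (hz : ‖z‖ = 1) (n : ℕ) : ‖oddPow n z‖ ≤ 2 := by
  refine (norm_sub_le _ _).trans ?_
  simp [hz]
  norm_num

lemma oddPow_mul_oddPow {z : ℂ} (hz : z ≠ 0) (n m : ℕ) :
    oddPow n z * oddPow m z = z ^ ((n : ℤ) + m + 2) - z ^ ((n : ℤ) - m) -
      (z ^ ((m : ℤ) - n) - z ^ (-((n : ℤ) + m + 2))) := by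
  simp only [oddPow, zpow_sub₀ hz, zpow_neg, zpow_add₀ hz, zpow_natCast, zpow_ofNat, inv_pow,
    pow_succ]
  field_simp

lemma integral_oddPow_mul_oddPow (n m : ℕ) :
    ∫ φ in (0 : ℝ)..(2 * π), oddPow n (Complex.exp (Complex.I * φ)) *
      oddPow m (Complex.exp (Complex.I * φ)) = if n = m then (-(4 * π) : ℂ) else 0 := by
  have hint : ∀ k : ℤ, IntervalIntegrable (fun φ : ℝ => Complex.exp (Complex.I * φ) ^ k) volume
      0 (2 * π) := fun k => by
    simp only [← Complex.exp_int_mul]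
    exact Continuous.intervalIntegrable (by fun_prop) _ _
  simp only [oddPow_mul_oddPow (Complex.exp_ne_zero _)]
  rw [intervalIntegral.integral_sub ((hint _).sub (hint _)) ((hint _).sub (hint _)),
    intervalIntegral.integral_sub (hint _) (hint _),
    intervalIntegral.integral_sub (hint _) (hint _)]
  simp only [integral_exp_zpow]
  rw [if_neg (by omega : ¬(n + m + 2 : ℤ) = 0), if_neg (by omega : ¬-(n + m + 2 : ℤ) = 0)]
  by_cases h : n = m
  · rw [if_pos (by omega), if_pos (by omega), if_pos h]
    ring
  · rw [if_neg (by omega), if_neg (by omega), if_neg h]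
    ring

lemma hasSum_integral_tsum_oddPow_mul {c : ℕ → ℂ} (hc : Summable fun n => ‖c n‖) {T : ℝ → ℂ}
    (hT : Continuous T) :
    HasSum (fun n => c n * ∫ φ in (0 : ℝ)..(2 * π), oddPow n (Complex.exp (Complex.I * φ)) * T φ)
      (∫ φ in (0 : ℝ)..(2 * π), (∑' n, c n * oddPow n (Complex.exp (Complex.I * φ))) * T φ) := by
  simp only [← intervalIntegral.integral_const_mul, ← mul_assoc]
  refine intervalIntegral.hasSum_integral_of_dominated_convergence
    (fun n φ => ‖c n‖ * (2 * ‖T φ‖)) (fun n => ?_) (fun n => ?_) ?_ ?_ ?_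
  · exact (((continuous_const.mul (continuous_oddPow_exp n)).mul hT)).aestronglyMeasurable
  · refine .of_forall fun φ _ => ?_
    rw [norm_mul, norm_mul, mul_assoc]
    gcongr
    exact norm_oddPow_le (norm_exp_I_mul φ) n
  · exact .of_forall fun φ _ => hc.mul_right _
  · simp only [tsum_mul_right]
    exact Continuous.intervalIntegrable (by fun_prop) _ _
  · refine .of_forall fun φ _ => HasSum.mul_right _ (Summable.hasSum ?_)
    refine Summable.of_norm_bounded (hc.mul_right 2) fun n => ?_
    rw [norm_mul]
    gcongr
    exact norm_oddPow_le (norm_exp_I_mul φ) n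

/-- Parseval's identity for odd Fourier series. -/
lemma integral_tsum_oddPow_mul_tsum_oddPow {c d : ℕ → ℂ} (hc : Summable fun n => ‖c n‖)
    (hd : Summable fun n => ‖d n‖) :
    ∫ φ in (0 : ℝ)..(2 * π), (∑' n, c n * oddPow n (Complex.exp (Complex.I * φ))) *
      (∑' n, d n * oddPow n (Complex.exp (Complex.I * φ))) = -(4 * π) * ∑' n, c n * d n := by
  have hcont : Continuous fun φ : ℝ => ∑' n, d n * oddPow n (Complex.exp (Complex.I * φ)) := by
    refine continuous_tsum (fun n => continuous_const.mul (continuous_oddPow_exp n))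
      (hd.mul_right 2) fun n φ => ?_
    rw [norm_mul]
    gcongr
    exact norm_oddPow_le (norm_exp_I_mul φ) n
  have hterm : ∀ n, ∫ φ in (0 : ℝ)..(2 * π), oddPow n (Complex.exp (Complex.I * φ)) *
      (∑' m, d m * oddPow m (Complex.exp (Complex.I * φ))) = -(4 * π) * d n := by
    intro n
    have h := hasSum_integral_tsum_oddPow_mul hd (continuous_oddPow_exp n)
    simp only [integral_oddPow_mul_oddPow, mul_ite, mul_zero] at h
    have h' := h.unique (hasSum_single n fun m hm => if_neg hm)
    rw [if_pos rfl, mul_comm (d n)] at h'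
    rw [← h']
    simp only [mul_comm]
  rw [← (hasSum_integral_tsum_oddPow_mul hc hcont).tsum_eq, ← tsum_mul_left]
  exact tsum_congr fun n => by rw [hterm]; ring

end Orthogonality

section Transformation

lemma oddPow_inv (n : ℕ) (z : ℂ) : oddPow n z⁻¹ = -oddPow n z := by
  simp [oddPow]

lemma thetaSeries_inv (q a b z : ℂ) : thetaSeries q a b z⁻¹ = -thetaSeries q a b z := by
  simp [thetaSeries, oddPow_inv, tsum_neg]

/-- The series expansion of `F`. -/
lemma Ffun_eq {p q a0 a1 b0 b1 : ℂ} (hp0 : p ≠ 0) (hp1 : ‖p‖ < 1) (hq0 : q ≠ 0) (hq1 : ‖q‖ < 1)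
    (ha0 : ‖q‖ < ‖a0‖) (ha0' : ‖a0‖ < 1) (ha1 : ‖q‖ < ‖a1‖) (ha1' : ‖a1‖ < 1)
    (hb0 : ‖p‖ < ‖b0‖) (hb0' : ‖b0‖ < 1) (hb1 : ‖p‖ < ‖b1‖) (hb1' : ‖b1‖ < 1)
    (h1 : ellTheta (a0 * a1) q ≠ 0) (h2 : ellTheta (a0 / a1) q ≠ 0)
    (h3 : ellTheta (b0 * b1) p ≠ 0) (h4 : ellTheta (b0 / b1) p ≠ 0) :
    Ffun a0 a1 b0 b1 p q =
      qPoch p * qPoch q * (∑' n, thetaCoeff q a0 a1 n * thetaCoeff p b0 b1 n) /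
        (eulerTheta q 1 * eulerTheta p 1 *
          (a1 * ellTheta (a0 * a1) q * ellTheta (a0 / a1) q) *
          (b1 * ellTheta (b0 * b1) p * ellTheta (b0 / b1) p)) := by
  have hint : ∀ z : ℂ, ‖z‖ = 1 → ellTheta (z ^ 2) q * ellTheta (1 / z ^ 2) p /
          (ellTheta (a0 * z) q * ellTheta (a0 / z) q * ellTheta (a1 * z) q *
            ellTheta (a1 / z) q * ellTheta (b0 * z) p * ellTheta (b0 / z) p *
            ellTheta (b1 * z) p * ellTheta (b1 / z) p) =
      -1 / (eulerTheta q 1 * eulerTheta p 1 *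
          (a1 * ellTheta (a0 * a1) q * ellTheta (a0 / a1) q) *
          (b1 * ellTheta (b0 * b1) p * ellTheta (b0 / b1) p)) *
        (thetaSeries q a0 a1 z * thetaSeries p b0 b1 z) := by
    intro z hz
    have hz0 : z ≠ 0 := by rintro rfl; simp at hz
    have e1 := ellTheta_quotient_eq hq0 hq1 ha0 ha0' ha1 ha1' h1 h2 hz
    have e2 := ellTheta_quotient_eq hp0 hp1 hb0 hb0' hb1 hb1' h3 h4 (z := z⁻¹) (by simp [hz])
    rw [thetaSeries_inv] at e2
    simp only [div_inv_eq_mul, ← div_eq_mul_inv, inv_pow] at e2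
    rw [one_div]
    have e3 := congrArg₂ (· * ·) e1 e2
    simp only [← mul_div_mul_comm] at e3
    convert e3 using 1
    · ring
    · rw [← mul_neg_one (z⁻¹)]
      field_simp
  rw [Ffun, integral_Icc_eq_integral_Ioc, ← intervalIntegral.integral_of_le (by positivity),
    intervalIntegral.integral_congr fun φ _ => hint _ (norm_exp_I_mul φ),
    intervalIntegral.integral_const_mul]
  simp only [thetaSeries]
  rw [integral_tsum_oddPow_mul_tsum_oddPow (summable_norm_thetaCoeff hq1 ha0 ha0' ha1 ha1')
    (summable_norm_thetaCoeff hp1 hb0 hb0' hb1 hb1')]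
  have hpi : (π : ℂ) ≠ 0 := by exact_mod_cast Real.pi_ne_zero
  push_cast
  field_simp
  ring

lemma thetaCoeff_mul_thetaCoeff {p q ω a0 a1 b0 b1 : ℂ} (hω0 : ω ≠ 0) (hω : ω ^ 2 = p * q)
    (ha0 : a0 ≠ 0) (ha1 : a1 ≠ 0) (hb0 : b0 ≠ 0) (hb1 : b1 ≠ 0) (n : ℕ) :
    thetaCoeff q (ω / b0) (ω / b1) n * thetaCoeff p (ω / a0) (ω / a1) n =
      thetaCoeff q a0 a1 n * thetaCoeff p b0 b1 n := by
  have key : ∀ {p q : ℂ}, ω ^ 2 = p * q → ∀ {b : ℂ}, b ≠ 0 →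
      (ω / b) ^ (n + 1) = (q / ω) ^ (n + 1) * (p / b) ^ (n + 1) ∧
        (q / (ω / b)) ^ (n + 1) = (q / ω) ^ (n + 1) * b ^ (n + 1) := by
    intro p q hω b hb
    rw [← mul_pow, ← mul_pow]
    constructor
    · congr 1
      field_simp
      linear_combination hω
    · congr 1
      field_simp
  have hpq : (q / ω) ^ (n + 1) * (p / ω) ^ (n + 1) = 1 := by
    rw [← mul_pow, show q / ω * (p / ω) = 1 by field_simp; linear_combination -hω, one_pow]
  have hω' : ω ^ 2 = q * p := by rw [hω, mul_comm]
  rw [thetaCoeff, thetaCoeff, thetaCoeff, thetaCoeff, (key hω hb0).1, (key hω hb0).2,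
    (key hω hb1).1, (key hω hb1).2, (key hω' ha0).1, (key hω' ha0).2, (key hω' ha1).1,
    (key hω' ha1).2, div_mul_div_comm, div_mul_div_comm]
  congr 1
  linear_combination ((p / b0) ^ (n + 1) + b0 ^ (n + 1) - (p / b1) ^ (n + 1) - b1 ^ (n + 1)) *
    ((q / a0) ^ (n + 1) + a0 ^ (n + 1) - (q / a1) ^ (n + 1) - a1 ^ (n + 1)) * hpq

/-- The theta factors of the transformed parameters. -/
lemma ellTheta_transformed {p q ω b0 b1 : ℂ} (hp0 : p ≠ 0) (hq0 : q ≠ 0) (hq1 : ‖q‖ < 1)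
    (hω0 : ω ≠ 0) (hω : ω ^ 2 = p * q) (hb0 : b0 ≠ 0) (hb1 : b1 ≠ 0) :
    ellTheta (ω / b0 * (ω / b1)) q = ellTheta (b0 * b1 / p) q ∧
      ellTheta (ω / b0 / (ω / b1)) q = -(b1 / b0) * ellTheta (b0 / b1) q := by
  constructor
  · rw [← ellTheta_div hq0 hq1 (div_ne_zero (mul_ne_zero hb0 hb1) hp0)]
    congr 1
    field_simp
    linear_combination hω
  · rw [← inv_div b0 b1, ← ellTheta_inv hq1 (div_ne_zero hb0 hb1)]
    congr 1
    field_simp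

/-- Nonvanishing of the theta factors of the transformed parameters. -/
lemma ellTheta_transformed_ne_zero {p q ω b0 b1 : ℂ} (hp0 : p ≠ 0) (hp1 : ‖p‖ < 1)
    (hq0 : q ≠ 0) (hq1 : ‖q‖ < 1) (hω : ω ^ 2 = p * q)
    (hb0 : ‖ω‖ < ‖b0‖) (hb0' : ‖b0‖ < ‖ω‖ / ‖q‖) (hb1 : ‖ω‖ < ‖b1‖) (hb1' : ‖b1‖ < ‖ω‖ / ‖q‖)
    (h3 : ellTheta (b0 * b1 / p) p ≠ 0) (h4 : ellTheta (b0 / b1) p ≠ 0) :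
    ellTheta (b0 * b1 / p) q ≠ 0 ∧ ellTheta (b0 / b1) q ≠ 0 := by
  have hp : 0 < ‖p‖ := norm_pos_iff.mpr hp0
  have hq : 0 < ‖q‖ := norm_pos_iff.mpr hq0
  have p0 : 0 < ‖b0‖ := (norm_nonneg ω).trans_lt hb0
  have p1 : 0 < ‖b1‖ := (norm_nonneg ω).trans_lt hb1
  have hω' : ‖ω‖ * ‖ω‖ = ‖p‖ * ‖q‖ := by rw [← norm_mul, ← norm_mul, ← hω, sq]
  rw [lt_div_iff₀ hq] at hb0' hb1'
  constructor
  · refine ellTheta_ne_zero hq1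
      (div_ne_zero (mul_ne_zero (norm_pos_iff.mp p0) (norm_pos_iff.mp p1)) hp0) ?_ ?_ ?_
    · rw [norm_mul, norm_div, norm_mul, ← mul_div_assoc, div_lt_one hp]
      have := mul_lt_mul'' hb0' hb1' (by positivity) (by positivity)
      rw [hω'] at this
      refine lt_of_mul_lt_mul_right (a := ‖q‖) ?_ hq.le
      linarith
    · rw [norm_div, norm_mul, lt_div_iff₀ hp, mul_comm, ← hω']
      exact mul_lt_mul'' hb0 hb1 (norm_nonneg _) (norm_nonneg _)
    · intro h
      rw [h, ellTheta_one hp1] at h3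
      exact h3 rfl
  · refine ellTheta_ne_zero hq1
      (div_ne_zero (norm_pos_iff.mp p0) (norm_pos_iff.mp p1)) ?_ ?_ ?_
    · rw [norm_mul, norm_div, ← mul_div_assoc, div_lt_one p1]
      linarith
    · rw [norm_div, lt_div_iff₀ p1]
      linarith
    · intro h
      rw [h, ellTheta_one hp1] at h4
      exact h4 rfl

lemma ellTheta_mul_eq {p b0 b1 : ℂ} (hp0 : p ≠ 0) (hp1 : ‖p‖ < 1) (hb0 : b0 ≠ 0) (hb1 : b1 ≠ 0) :
    ellTheta (b0 * b1) p = -(p / (b0 * b1)) * ellTheta (b0 * b1 / p) p := by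
  have h := ellTheta_mul_left hp0 hp1 (div_ne_zero (mul_ne_zero hb0 hb1) hp0)
  rwa [mul_div_cancel₀ _ hp0, inv_div] at h

end Transformation

/-- The base-case transformation of `F` (Lemma 3.3). -/
theorem basecase_xform (p q ω a0 a1 b0 b1 : ℂ)
    (hp0 : 0 < ‖p‖) (hp1 : ‖p‖ < 1)
    (hq0 : 0 < ‖q‖) (hq1 : ‖q‖ < 1)
    (hω : ω ^ 2 = p * q)
    (ha0l : max ‖q‖ ‖ω‖ < ‖a0‖)
    (ha0u : ‖a0‖ < min 1 (‖ω‖ / ‖p‖))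
    (ha1l : max ‖q‖ ‖ω‖ < ‖a1‖)
    (ha1u : ‖a1‖ < min 1 (‖ω‖ / ‖p‖))
    (hb0l : max ‖p‖ ‖ω‖ < ‖b0‖)
    (hb0u : ‖b0‖ < min 1 (‖ω‖ / ‖q‖))
    (hb1l : max ‖p‖ ‖ω‖ < ‖b1‖)
    (hb1u : ‖b1‖ < min 1 (‖ω‖ / ‖q‖))
    (h1 : ellTheta (a0 * a1 / q) q ≠ 0) (h2 : ellTheta (a0 / a1) q ≠ 0)
    (h3 : ellTheta (b0 * b1 / p) p ≠ 0) (h4 : ellTheta (b0 / b1) p ≠ 0) :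
    Ffun a0 a1 b0 b1 p q =
      (ellTheta (a0 * a1 / q) p * ellTheta (a0 / a1) p *
        ellTheta (b0 * b1 / p) q * ellTheta (b0 / b1) q /
        (ellTheta (a0 * a1 / q) q * ellTheta (a0 / a1) q *
          ellTheta (b0 * b1 / p) p * ellTheta (b0 / b1) p)) *
      Ffun (ω / b0) (ω / b1) (ω / a0) (ω / a1) p q := by
  rw [max_lt_iff] at ha0l ha1l hb0l hb1l
  rw [lt_min_iff] at ha0u ha1u hb0u hb1u
  have hp : p ≠ 0 := norm_pos_iff.mp hp0
  have hq : q ≠ 0 := norm_pos_iff.mp hq0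
  have hω0 : ω ≠ 0 := by
    rintro rfl
    exact mul_ne_zero hp hq (by simpa using hω.symm)
  have hω' : ω ^ 2 = q * p := by rw [hω, mul_comm]
  have ne : ∀ {a : ℂ}, ‖ω‖ < ‖a‖ → a ≠ 0 := fun h => norm_pos_iff.mp ((norm_nonneg ω).trans_lt h)
  have a0n := ne ha0l.2
  have a1n := ne ha1l.2
  have b0n := ne hb0l.2
  have b1n := ne hb1l.2
  have lower : ∀ {r c : ℂ}, r ≠ 0 → ‖ω‖ < ‖c‖ → ‖c‖ < ‖ω‖ / ‖r‖ → ‖r‖ < ‖ω / c‖ := by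
    intro r c hr hc hc'
    rw [norm_div, lt_div_iff₀ ((norm_nonneg ω).trans_lt hc), mul_comm]
    rwa [lt_div_iff₀ (norm_pos_iff.mpr hr)] at hc'
  have upper : ∀ {c : ℂ}, ‖ω‖ < ‖c‖ → ‖ω / c‖ < 1 := fun hc => by
    rwa [norm_div, div_lt_one ((norm_nonneg ω).trans_lt hc)]
  obtain ⟨y1, y2⟩ :=
    ellTheta_transformed_ne_zero hq hq1 hp hp1 hω' ha0l.2 ha0u.2 ha1l.2 ha1u.2 h1 h2
  obtain ⟨y3, y4⟩ :=
    ellTheta_transformed_ne_zero hp hp1 hq hq1 hω hb0l.2 hb0u.2 hb1l.2 hb1u.2 h3 h4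
  obtain ⟨t1, t2⟩ := ellTheta_transformed hq hp hp1 hω0 hω' a0n a1n
  obtain ⟨t3, t4⟩ := ellTheta_transformed hp hq hq1 hω0 hω b0n b1n
  have m1 := ellTheta_mul_eq hq hq1 a0n a1n
  have m3 := ellTheta_mul_eq hp hp1 b0n b1n
  rw [Ffun_eq hp hp1 hq hq1 ha0l.1 ha0u.1 ha1l.1 ha1u.1 hb0l.1 hb0u.1 hb1l.1 hb1u.1
      (by simp [m1, hq, a0n, a1n, h1]) h2 (by simp [m3, hp, b0n, b1n, h3]) h4,
    Ffun_eq hp hp1 hq hq1 (lower hq hb0l.2 hb0u.2) (upper hb0l.2) (lower hq hb1l.2 hb1u.2)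
      (upper hb1l.2) (lower hp ha0l.2 ha0u.2) (upper ha0l.2) (lower hp ha1l.2 ha1u.2)
      (upper ha1l.2) (by rwa [t3]) (by simp [t4, b0n, b1n, y4]) (by rwa [t1])
      (by simp [t2, a0n, a1n, y2]), t1, t2, t3, t4, m1, m3]
  simp only [thetaCoeff_mul_thetaCoeff hω0 hω a0n a1n b0n b1n]
  generalize ellTheta (a0 * a1 / q) p = Y1, ellTheta (a0 / a1) p = Y2,
    ellTheta (b0 * b1 / p) q = Y3, ellTheta (b0 / b1) q = Y4,
    ellTheta (a0 * a1 / q) q = X1, ellTheta (a0 / a1) q = X2,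
    ellTheta (b0 * b1 / p) p = X3, ellTheta (b0 / b1) p = X4 at *
  have hDq : eulerTheta q 1 ≠ 0 := eulerTheta_one_ne_zero hq1
  have hDp : eulerTheta p 1 ≠ 0 := eulerTheta_one_ne_zero hp1
  field_simp
  rw [hω]
  ring
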